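/- arXiv:1308.3298 — 2 statements merged into one kernel-verified Lean document; each statement's English description precedes it below -/
import Mathlib

section
/- Let |γ| < 1. For every λ in the open unit disc 𝔻, the characteristic function θ_γ of U_γ, computed with respect to the basis vectors b₁ ∈ 𝔇_{U_γ} and b ∈ 𝔇_{U_γ*}, satisfies θ_γ(λ) = −γ + (1−|γ|²)R₁μ(λ)/(1 + (1−γ̄)R₁μ(λ)) = ((1−γ)R₂μ(λ) − (1+γ))/((1−γ̄)R₂μ(λ) + (1+γ̄)); equivalently, (−U_γ + λ D_{U_γ*}(I − λU_γ*)⁻¹ D_{U_γ}) b₁ = [−γ + (1−|γ|²)R₁μ(λ)/(1 + (1−γ̄)R₁μ(λ))] · b in L²(μ). -/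
open MeasureTheory Complex Filter Metric ContinuousLinearMap
open scoped ComplexConjugate ENNReal NNReal

noncomputable section

/-- The rank one operator `f ↦ ⟨f, y⟩ x` (inner product linear in the first slot,
as in the paper). -/
def rankOne {H : Type*} [NormedAddCommGroup H] [InnerProductSpace ℂ H] (x y : H) :
    H →L[ℂ] H :=
  (innerSL ℂ y).smulRight x

/-- The Cauchy type transform `R₁τ(λ) = ∫ ξ̄λ/(1-ξ̄λ) dτ(ξ)`. -/
def R1t (μ : Measure ℂ) (lam : ℂ) : ℂ :=
  ∫ ξ, (conj ξ * lam) / (1 - conj ξ * lam) ∂μ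

/-- The Cauchy type transform `R₂τ(λ) = ∫ (1+ξ̄λ)/(1-ξ̄λ) dτ(ξ)`. -/
def R2t (μ : Measure ℂ) (lam : ℂ) : ℂ :=
  ∫ ξ, (1 + conj ξ * lam) / (1 - conj ξ * lam) ∂μ

section Hilbert

variable {H : Type*} [NormedAddCommGroup H] [InnerProductSpace ℂ H]

lemma rankOne_apply (x y f : H) : rankOne x y f = inner ℂ y f • x := by
  simp [rankOne]

lemma isPositive_rankOne (v : H) : (rankOne v v).IsPositive := by
  rw [isPositive_iff_complex]
  intro f
  rw [rankOne_apply, inner_smul_left, Complex.conj_mul', ← Complex.ofReal_pow]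
  exact ⟨rfl, by simp [-Complex.ofReal_pow]⟩

variable [CompleteSpace H]

lemma adjoint_rankOne (x y : H) : adjoint (rankOne x y) = rankOne y x := by
  symm
  rw [eq_adjoint_iff]
  intro f g
  simp only [rankOne_apply, inner_smul_left, inner_smul_right, inner_conj_symm]
  ring

/-- The positive square root of `s² • v v*`, for a unit vector `v`, is `s • v v*`. -/
lemma eq_smul_rankOne_of_sq {v : H} (hv : ‖v‖ = 1) {s : ℝ} (hs : 0 ≤ s) {D : H →L[ℂ] H}
    (hD : D.IsPositive) (h : D ∘L D = ((s : ℂ) ^ 2) • rankOne v v) :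
    D = (s : ℂ) • rankOne v v := by
  have hE : ((s : ℂ) • rankOne v v).IsPositive :=
    (isPositive_rankOne v).smul_of_nonneg (by exact_mod_cast hs)
  have hEsq : ((s : ℂ) • rankOne v v) * ((s : ℂ) • rankOne v v) = D * D := by
    rw [show D * D = D ∘L D from rfl, h]
    ext f
    simp only [mul_apply_eq_comp, _root_.smul_apply, rankOne_apply,
      map_smul, inner_self_eq_norm_sq_to_K, hv, smul_smul]
    congr 1
    simp
    ring
  rw [← nonneg_iff_isPositive] at hD hE
  rw [← CFC.sqrt_unique hEsq hE, CFC.sqrt_unique rfl hD]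

/-- An operator `T` with a positive defect operator `D`, `D² = I - T*T`, is a contraction. -/
lemma norm_le_one_of_defect {T D : H →L[ℂ] H} (hD : D.IsPositive)
    (h : D ∘L D = 1 - adjoint T ∘L T) : ‖T‖ ≤ 1 := by
  refine opNorm_le_bound _ zero_le_one fun f => ?_
  have h1 : inner ℂ (D (D f)) f = inner ℂ f f - inner ℂ (adjoint T (T f)) f := by
    rw [← inner_sub_left]
    exact congrArg (fun A : H →L[ℂ] H => inner ℂ (A f) f) h
  have h2 : inner ℂ (D (D f)) f = inner ℂ (D f) (D f) := by
    exact hD.isSymmetric (D f) f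
  rw [h2, adjoint_inner_left, inner_self_eq_norm_sq_to_K, inner_self_eq_norm_sq_to_K,
    inner_self_eq_norm_sq_to_K] at h1
  have h3 : ‖D f‖ ^ 2 = ‖f‖ ^ 2 - ‖T f‖ ^ 2 := by exact_mod_cast h1
  rw [one_mul]
  nlinarith [norm_nonneg f, norm_nonneg (T f), sq_nonneg ‖D f‖]

variable {U : H →L[ℂ] H} {b b₁ : H} {γ : ℂ}

lemma adjoint_rankOne_perturbation :
    adjoint (U + (γ - 1) • rankOne b b₁) = adjoint U + (conj γ - 1) • rankOne b₁ b := by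
  simp [map_smulₛₗ, adjoint_rankOne]

lemma one_sub_adjoint_comp_self (hU : adjoint U ∘L U = 1) (hb : U b₁ = b) (hb₁ : ‖b₁‖ = 1) :
    1 - adjoint (U + (γ - 1) • rankOne b b₁) ∘L (U + (γ - 1) • rankOne b b₁)
      = (1 - (‖γ‖ : ℂ) ^ 2) • rankOne b₁ b₁ := by
  have h (f : H) : adjoint U (U f) = f := congrArg (fun A : H →L[ℂ] H => A f) hU
  have h1 : inner ℂ b₁ b₁ = (1 : ℂ) := by simp [inner_self_eq_norm_sq_to_K, hb₁]
  have h2 (f : H) : inner ℂ b (U f) = inner ℂ b₁ f := by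
    rw [← hb, ← adjoint_inner_right, h]
  have h3 : inner ℂ b b = (1 : ℂ) := by nth_rw 2 [← hb]; rw [h2, h1]
  have h4 : adjoint U b = b₁ := by rw [← hb, h]
  rw [adjoint_rankOne_perturbation]
  ext f
  simp only [_root_.sub_apply, one_apply_eq_self,
    ContinuousLinearMap.comp_apply, _root_.add_apply,
    _root_.smul_apply, rankOne_apply, map_add, map_smul, h, h2, h3, h4,
    ← Complex.mul_conj']
  module

lemma one_sub_comp_adjoint_self (hU : adjoint U ∘L U = 1) (hU' : U ∘L adjoint U = 1)
    (hb : U b₁ = b) (hb₁ : ‖b₁‖ = 1) :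
    1 - (U + (γ - 1) • rankOne b b₁) ∘L adjoint (U + (γ - 1) • rankOne b b₁)
      = (1 - (‖γ‖ : ℂ) ^ 2) • rankOne b b := by
  have h4 : adjoint U b = b₁ := by
    rw [← hb]; exact congrArg (fun A : H →L[ℂ] H => A b₁) hU
  have hb' : ‖b‖ = 1 := by
    rw [← hb, ← hb₁]
    exact (norm_map_iff_adjoint_comp_self U).2 hU b₁
  have := one_sub_adjoint_comp_self (γ := conj γ) (U := adjoint U) (b := b₁) (b₁ := b)
    (by rwa [adjoint_adjoint]) h4 hb'
  rw [adjoint_rankOne_perturbation, Complex.conj_conj, adjoint_adjoint, Complex.norm_conj] at this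
  rw [adjoint_rankOne_perturbation, this]

/-- The defect operators of `U + (γ - 1) b b₁*` reduce the characteristic function at `b₁` to
the coefficient `⟨g, b⟩` of the solution `g` of `(I - λ U_γ*) g = b₁`. -/
lemma exists_charFun_eq (hU : adjoint U ∘L U = 1) (hU' : U ∘L adjoint U = 1)
    (hb : U b₁ = b) (hb₁ : ‖b₁‖ = 1) (hγ : ‖γ‖ < 1)
    {T D Dstar : H →L[ℂ] H} (hT : T = U + (γ - 1) • rankOne b b₁)
    (hDpos : D.IsPositive) (hDsq : D ∘L D = 1 - adjoint T ∘L T)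
    (hDspos : Dstar.IsPositive) (hDssq : Dstar ∘L Dstar = 1 - T ∘L adjoint T)
    {lam : ℂ} (hlam : ‖lam‖ < 1) :
    ∃ g : H, g = lam • adjoint U g + (1 - (1 - conj γ) * (lam * inner ℂ b g)) • b₁ ∧
      (-T + lam • (Dstar ∘L Ring.inverse (1 - lam • adjoint T) ∘L D)) b₁
        = (-γ + (1 - (‖γ‖ : ℂ) ^ 2) * (lam * inner ℂ b g)) • b := by
  have hb' : ‖b‖ = 1 := by
    rw [← hb, ← hb₁]
    exact (norm_map_iff_adjoint_comp_self U).2 hU b₁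
  have hs0 : 0 ≤ 1 - ‖γ‖ ^ 2 := by nlinarith [norm_nonneg γ]
  have hs2 : ((√(1 - ‖γ‖ ^ 2) : ℝ) : ℂ) ^ 2 = 1 - (‖γ‖ : ℂ) ^ 2 := by
    rw [← Complex.ofReal_pow, Real.sq_sqrt hs0]; push_cast; rfl
  have hD := eq_smul_rankOne_of_sq hb₁ (Real.sqrt_nonneg (1 - ‖γ‖ ^ 2)) hDpos
    (by rw [hDsq, hs2, hT, one_sub_adjoint_comp_self hU hb hb₁])
  have hDs := eq_smul_rankOne_of_sq hb' (Real.sqrt_nonneg (1 - ‖γ‖ ^ 2)) hDspos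
    (by rw [hDssq, hs2, hT, one_sub_comp_adjoint_self hU hU' hb hb₁])
  have hTn : ‖lam • adjoint T‖ < 1 := by
    rw [norm_smul, LinearIsometryEquiv.norm_map]
    nlinarith [norm_le_one_of_defect hDpos hDsq, norm_nonneg T, norm_nonneg lam]
  have hunit : IsUnit (1 - lam • adjoint T) := isUnit_one_sub_of_norm_lt_one hTn
  have h1 : inner ℂ b₁ b₁ = (1 : ℂ) := by simp [inner_self_eq_norm_sq_to_K, hb₁]
  refine ⟨Ring.inverse (1 - lam • adjoint T) b₁, ?_, ?_⟩
  · have hg : (1 - lam • adjoint T) (Ring.inverse (1 - lam • adjoint T) b₁) = b₁ :=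
      congrArg (fun A : H →L[ℂ] H => A b₁) (Ring.mul_inverse_cancel _ hunit)
    generalize Ring.inverse (1 - lam • adjoint T) b₁ = g at hg ⊢
    rw [hT, adjoint_rankOne_perturbation] at hg
    simp only [_root_.sub_apply, one_apply_eq_self,
      _root_.add_apply, _root_.smul_apply, rankOne_apply] at hg
    linear_combination (norm := module) hg
  · have hTb : T b₁ = γ • b := by
      rw [hT]
      simp only [_root_.add_apply, _root_.smul_apply, rankOne_apply,
        hb, h1]
      module
    rw [hDs, hD]
    simp only [_root_.add_apply, _root_.neg_apply, hTb,
      _root_.smul_apply, ContinuousLinearMap.comp_apply, rankOne_apply, h1,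
      map_smul, ← hs2]
    module

end Hilbert

section Multiplication

variable {μ : Measure ℂ}

lemma adjoint_mulOperator_comp_self (hμ : ∀ᵐ ξ ∂μ, ‖ξ‖ = 1) {U : Lp ℂ 2 μ →L[ℂ] Lp ℂ 2 μ}
    (hU : ∀ f : Lp ℂ 2 μ, ∀ᵐ ξ ∂μ, (U f) ξ = ξ * f ξ) : adjoint U ∘L U = 1 := by
  refine (norm_map_iff_adjoint_comp_self U).1 fun f => ?_
  rw [Lp.norm_def, Lp.norm_def]
  congr 1
  refine eLpNorm_congr_norm_ae ?_
  filter_upwards [hμ, hU f] with ξ h1 h2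
  rw [h2, norm_mul, h1, one_mul]

lemma exists_conj_mul (hμ : ∀ᵐ ξ ∂μ, ‖ξ‖ = 1) (f : Lp ℂ 2 μ) :
    ∃ h : Lp ℂ 2 μ, ∀ᵐ ξ ∂μ, h ξ = conj ξ * f ξ := by
  have hm : MemLp (fun ξ => conj ξ * f ξ) 2 μ := by
    refine (Lp.memLp f).of_le (by fun_prop) ?_
    filter_upwards [hμ] with ξ h1
    rw [norm_mul, Complex.norm_conj, h1, one_mul]
  exact ⟨hm.toLp _, hm.coeFn_toLp⟩

lemma mulOperator_apply_conj_mul (hμ : ∀ᵐ ξ ∂μ, ‖ξ‖ = 1) {U : Lp ℂ 2 μ →L[ℂ] Lp ℂ 2 μ}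
    (hU : ∀ f : Lp ℂ 2 μ, ∀ᵐ ξ ∂μ, (U f) ξ = ξ * f ξ) {f h : Lp ℂ 2 μ}
    (hh : ∀ᵐ ξ ∂μ, h ξ = conj ξ * f ξ) : U h = f := by
  refine Lp.ext ?_
  filter_upwards [hμ, hU h, hh] with ξ h1 h2 h3
  rw [h2, h3, ← mul_assoc, Complex.mul_conj', h1]
  simp

lemma mulOperator_comp_adjoint (hμ : ∀ᵐ ξ ∂μ, ‖ξ‖ = 1) {U : Lp ℂ 2 μ →L[ℂ] Lp ℂ 2 μ}
    (hU : ∀ f : Lp ℂ 2 μ, ∀ᵐ ξ ∂μ, (U f) ξ = ξ * f ξ) : U ∘L adjoint U = 1 := by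
  refine ContinuousLinearMap.ext fun f => ?_
  obtain ⟨h, hh⟩ := exists_conj_mul hμ f
  have h1 := mulOperator_apply_conj_mul hμ hU hh
  have h2 : adjoint U (U h) = h :=
    congrArg (fun A : Lp ℂ 2 μ →L[ℂ] Lp ℂ 2 μ => A h) (adjoint_mulOperator_comp_self hμ hU)
  rw [h1] at h2
  simp [h2, h1]

lemma adjoint_mulOperator_ae (hμ : ∀ᵐ ξ ∂μ, ‖ξ‖ = 1) {U : Lp ℂ 2 μ →L[ℂ] Lp ℂ 2 μ}
    (hU : ∀ f : Lp ℂ 2 μ, ∀ᵐ ξ ∂μ, (U f) ξ = ξ * f ξ) (f : Lp ℂ 2 μ) :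
    ∀ᵐ ξ ∂μ, (adjoint U f) ξ = conj ξ * f ξ := by
  obtain ⟨h, hh⟩ := exists_conj_mul hμ f
  have h2 : adjoint U (U h) = h :=
    congrArg (fun A : Lp ℂ 2 μ →L[ℂ] Lp ℂ 2 μ => A h) (adjoint_mulOperator_comp_self hμ hU)
  rw [mulOperator_apply_conj_mul hμ hU hh] at h2
  rwa [h2]

lemma norm_le_norm_one_sub_conj_mul {ξ lam : ℂ} (hξ : ‖ξ‖ = 1) :
    1 - ‖lam‖ ≤ ‖1 - conj ξ * lam‖ := by
  have := norm_sub_norm_le 1 (conj ξ * lam)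
  rwa [norm_mul, Complex.norm_conj, hξ, one_mul, norm_one] at this

lemma one_sub_conj_mul_ne_zero {ξ lam : ℂ} (hξ : ‖ξ‖ = 1) (hlam : ‖lam‖ < 1) :
    1 - conj ξ * lam ≠ 0 :=
  norm_pos_iff.1 ((sub_pos.2 hlam).trans_le (norm_le_norm_one_sub_conj_mul hξ))

lemma R2t_eq [IsProbabilityMeasure μ] (hμ : ∀ᵐ ξ ∂μ, ‖ξ‖ = 1) {lam : ℂ} (hlam : ‖lam‖ < 1) :
    R2t μ lam = 1 + 2 * R1t μ lam := by
  have hint : Integrable (fun ξ => (conj ξ * lam) / (1 - conj ξ * lam)) μ := by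
    refine Integrable.of_bound (C := ‖lam‖ / (1 - ‖lam‖))
      (Measurable.aestronglyMeasurable (by fun_prop)) ?_
    filter_upwards [hμ] with ξ h1
    rw [norm_div, norm_mul, Complex.norm_conj, h1, one_mul]
    have := norm_le_norm_one_sub_conj_mul (lam := lam) h1
    have := sub_pos.2 hlam
    gcongr
  calc R2t μ lam = ∫ ξ, (1 + 2 * ((conj ξ * lam) / (1 - conj ξ * lam))) ∂μ := by
        refine integral_congr_ae ?_
        filter_upwards [hμ] with ξ h1
        have := one_sub_conj_mul_ne_zero h1 hlam
        field_simp
        ring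
    _ = 1 + 2 * R1t μ lam := by
        rw [integral_add (integrable_const _) (hint.const_mul 2), integral_const_mul]
        simp [R1t]

lemma lam_mul_inner_eq_R1t (hμ : ∀ᵐ ξ ∂μ, ‖ξ‖ = 1) {b g : Lp ℂ 2 μ} {lam k : ℂ}
    (hb : ∀ᵐ ξ ∂μ, b ξ = 1) (hlam : ‖lam‖ < 1)
    (hg : ∀ᵐ ξ ∂μ, g ξ = lam * (conj ξ * g ξ) + k * conj ξ) :
    lam * inner ℂ b g = k * R1t μ lam := by
  rw [L2.inner_def, R1t, ← integral_const_mul, ← integral_const_mul]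
  refine integral_congr_ae ?_
  filter_upwards [hμ, hb, hg] with ξ h1 h2 h3
  have h4 := one_sub_conj_mul_ne_zero h1 hlam
  simp only [h2, RCLike.inner_apply, map_one, mul_one]
  rw [← mul_div_assoc, eq_div_iff h4]
  linear_combination lam * h3

end Multiplication

/-- For `|γ| < 1` and `U_γ = U + (γ-1) b b₁*`, the characteristic function
of `U_γ` with respect to the basis vectors `b₁` of `𝔇_{U_γ}` and `b` of `𝔇_{U_γ*}` is
`θ_γ(λ) = -γ + (1-|γ|²)R₁μ(λ)/(1+(1-γ̄)R₁μ(λ))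
        = ((1-γ)R₂μ(λ)-(1+γ))/((1-γ̄)R₂μ(λ)+(1+γ̄))` for `λ ∈ 𝔻`.  The defect operators are
encoded as the (unique) positive square roots of `I - U_γ*U_γ`, resp. `I - U_γU_γ*`. -/
theorem statement1
    (μ : Measure ℂ) [IsProbabilityMeasure μ] (hμ : ∀ᵐ ξ ∂μ, ‖ξ‖ = 1)
    (U : Lp ℂ 2 μ →L[ℂ] Lp ℂ 2 μ)
    (hU : ∀ f : Lp ℂ 2 μ, ∀ᵐ ξ ∂μ, (U f) ξ = ξ * f ξ)
    (b b₁ : Lp ℂ 2 μ)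
    (hb : ∀ᵐ ξ ∂μ, b ξ = 1) (hb₁ : ∀ᵐ ξ ∂μ, b₁ ξ = conj ξ)
    (γ : ℂ) (hγ : ‖γ‖ < 1)
    (Uγ : Lp ℂ 2 μ →L[ℂ] Lp ℂ 2 μ) (hUγ : Uγ = U + (γ - 1) • rankOne b b₁)
    -- the defect operator `D_{U_γ} = (I - U_γ*U_γ)^{1/2}`:
    (D : Lp ℂ 2 μ →L[ℂ] Lp ℂ 2 μ)
    (hDpos : D.IsPositive) (hDsq : D ∘L D = 1 - adjoint Uγ ∘L Uγ)
    -- the defect operator `D_{U_γ*} = (I - U_γU_γ*)^{1/2}`: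
    (Dstar : Lp ℂ 2 μ →L[ℂ] Lp ℂ 2 μ)
    (hDspos : Dstar.IsPositive) (hDssq : Dstar ∘L Dstar = 1 - Uγ ∘L adjoint Uγ)
    (lam : ℂ) (hlam : ‖lam‖ < 1) :
    (-Uγ + lam • (Dstar ∘L Ring.inverse (1 - lam • adjoint Uγ) ∘L D)) b₁
        = (-γ + (1 - (‖γ‖ : ℂ) ^ 2) * R1t μ lam / (1 + (1 - conj γ) * R1t μ lam)) • b ∧
      -γ + (1 - (‖γ‖ : ℂ) ^ 2) * R1t μ lam / (1 + (1 - conj γ) * R1t μ lam)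
        = ((1 - γ) * R2t μ lam - (1 + γ)) / ((1 - conj γ) * R2t μ lam + (1 + conj γ)) := by
  have hUU := adjoint_mulOperator_comp_self hμ hU
  have hUb : U b₁ = b := mulOperator_apply_conj_mul hμ hU (by
    filter_upwards [hb, hb₁] with ξ h1 h2
    rw [h1, h2, mul_one])
  have hbn : inner ℂ b b = (1 : ℂ) := by
    rw [L2.inner_def]
    calc ∫ ξ, inner ℂ (b ξ) (b ξ) ∂μ = ∫ _, (1 : ℂ) ∂μ := by
          refine integral_congr_ae ?_
          filter_upwards [hb] with ξ h1
          simp [h1]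
      _ = 1 := by simp
  have hb₁n : ‖b₁‖ = 1 := by
    rw [← (norm_map_iff_adjoint_comp_self U).2 hUU b₁, hUb]
    rw [inner_self_eq_norm_sq_to_K] at hbn
    have : ‖b‖ ^ 2 = 1 := by exact Complex.ofReal_injective (by simpa using hbn)
    nlinarith [norm_nonneg b]
  obtain ⟨g, hg, hθ⟩ := exists_charFun_eq hUU (mulOperator_comp_adjoint hμ hU) hUb hb₁n hγ hUγ
    hDpos hDsq hDspos hDssq hlam
  have key : lam * inner ℂ b g
      = (1 - (1 - conj γ) * (lam * inner ℂ b g)) * R1t μ lam := by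
    refine lam_mul_inner_eq_R1t hμ hb hlam ?_
    generalize 1 - (1 - conj γ) * (lam * inner ℂ b g) = k at hg
    have hg' : (g : ℂ → ℂ) =ᵐ[μ] (lam • adjoint U g + k • b₁ : Lp ℂ 2 μ) := by rw [← hg]
    filter_upwards [hg', Lp.coeFn_add (lam • adjoint U g) (k • b₁),
      Lp.coeFn_smul lam (adjoint U g), Lp.coeFn_smul k b₁, hb₁,
      adjoint_mulOperator_ae hμ hU g] with ξ h1 h2 h3 h4 h5 h6
    refine (h1.trans h2).trans ?_
    rw [Pi.add_apply, h3, h4, Pi.smul_apply, Pi.smul_apply, h5, h6, smul_eq_mul, smul_eq_mul]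
  have hne : 1 + (1 - conj γ) * R1t μ lam ≠ 0 := by
    intro h0
    have hR : R1t μ lam = 0 := by linear_combination (lam * inner ℂ b g) * h0 - key
    simp [hR] at h0
  refine ⟨?_, ?_⟩
  · have hc : lam * inner ℂ b g = R1t μ lam / (1 + (1 - conj γ) * R1t μ lam) := by
      rw [eq_div_iff hne]
      linear_combination key
    rw [hθ, hc, mul_div_assoc]
  · have hden : (1 - conj γ) * R2t μ lam + (1 + conj γ)
        = 2 * (1 + (1 - conj γ) * R1t μ lam) := by rw [R2t_eq hμ hlam]; ring
    rw [hden, R2t_eq hμ hlam, ← Complex.mul_conj']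
    rw [eq_div_iff (mul_ne_zero two_ne_zero hne)]
    linear_combination 2 * div_mul_cancel₀ ((1 - γ * conj γ) * R1t μ lam) hne
end
end

section
/- Let |γ| < 1 and v(z) = ‖B_γ(z)‖²_{ℂ²} on 𝕋. For r ∈ [0,∞) ∖ {1}, let T_r : L²(μ) → L²(v dm) be the integral operator (T_r f)(z) = ∫_𝕋 f(ξ)/(1 − rξ̄z) dμ(ξ). Then the operators T_r are uniformly bounded in r: there is a constant C (one may take C = 4) such that ‖T_r‖_{L²(μ)→L²(v dm)} ≤ C for all r ∈ [0,∞) ∖ {1}. -/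
open MeasureTheory Complex Filter Metric ContinuousLinearMap
open scoped ComplexConjugate ENNReal NNReal Topology

noncomputable section

/-- Normalized Lebesgue (arclength) measure on the unit circle, as a measure on `ℂ`. -/
def circleMeasure : Measure ℂ :=
  (ENNReal.ofReal (2 * Real.pi)⁻¹) •
    Measure.map (fun t : ℝ => Complex.exp (t * Complex.I))
      (volume.restrict (Set.Ioc 0 (2 * Real.pi)))

/-- `f` has nontangential limit `L` at the boundary point `z` from inside the unit disc:
convergence along every Stolz angle at `z`. -/
def NTlimIn (f : ℂ → ℂ) (z L : ℂ) : Prop :=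
  ∀ C : ℝ, 1 < C →
    Tendsto f (𝓝[{w : ℂ | ‖w‖ < 1 ∧ ‖w - z‖ ≤ C * (1 - ‖w‖)}] z) (𝓝 L)

/-- `f` has nontangential limit `L` at the boundary point `z` from outside the unit disc. -/
def NTlimOut (f : ℂ → ℂ) (z L : ℂ) : Prop :=
  ∀ C : ℝ, 1 < C →
    Tendsto f (𝓝[{w : ℂ | 1 < ‖w‖ ∧ ‖w - z‖ ≤ C * (‖w‖ - 1)}] z) (𝓝 L)

/-- `θ_γ(λ) = -γ + (1-|γ|²)R₁μ(λ)/(1 + (1-γ̄)R₁μ(λ))`, the characteristic function of `U_γ`. -/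
def thetaG (γ : ℂ) (μ : Measure ℂ) (lam : ℂ) : ℂ :=
  -γ + (1 - (‖γ‖ : ℂ) ^ 2) * R1t μ lam / (1 + (1 - conj γ) * R1t μ lam)

/-- First component of `B_γ(z) = c^γ(z) - z c₁^γ(z)`, written in terms of the boundary
values `Θγ` of `θ_γ`. -/
def BgammaFst (γ : ℂ) (Θγ : ℂ → ℂ) (z : ℂ) : ℂ :=
  ((Real.sqrt (1 - ‖γ‖ ^ 2))⁻¹ : ℂ) * (1 + (conj γ - 1) * Θγ z - γ)

/-- Second component of `B_γ(z) = c^γ(z) - z c₁^γ(z)`. -/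
def BgammaSnd (γ : ℂ) (Θγ : ℂ → ℂ) (z : ℂ) : ℂ :=
  ((Real.sqrt (1 - ‖γ‖ ^ 2))⁻¹ : ℂ) *
    ((conj γ - 1) * (Real.sqrt (1 - ‖Θγ z‖ ^ 2) : ℂ))

/-- The weight `v(z) = ‖B_γ(z)‖²_{ℂ²}`. -/
def vWeight (γ : ℂ) (Θγ : ℂ → ℂ) (z : ℂ) : ℝ :=
  ‖BgammaFst γ Θγ z‖ ^ 2 + ‖BgammaSnd γ Θγ z‖ ^ 2


section Abstract
variable {H : Type*} [NormedAddCommGroup H] [InnerProductSpace ℂ H]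

theorem norm_sub_smul_inner_smul_le {a : ℂ} (ha : ‖a‖ ^ 2 ≤ 2 * a.re) {b : H} (hb : ‖b‖ = 1)
    (x : H) : ‖x - (a * inner ℂ b x) • b‖ ^ 2 ≤ ‖x‖ ^ 2 := by
  rw [@norm_sub_sq ℂ, inner_smul_right, norm_smul, hb, norm_mul, ← inner_conj_symm x b]
  set c := inner ℂ b x
  have h1 : a * c * conj c = a * ((‖c‖ ^ 2 : ℝ) : ℂ) := by
    rw [mul_assoc, Complex.mul_conj, Complex.normSq_eq_norm_sq]
  rw [h1]
  simp only [RCLike.re_to_complex, Complex.re_mul_ofReal]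
  nlinarith [sq_nonneg ‖c‖]

/-- The pointwise estimate behind the boundedness of the Cauchy transform: `x` and `y` are the
resolvents of the isometry `V` and of its rank-one perturbation, applied to `f`. -/
theorem re_inner_mul_conj_inner_le (V : H →ₗᵢ[ℂ] H) {a : ℂ} (ha : ‖a‖ ^ 2 ≤ 2 * a.re)
    {b : H} (hb : ‖b‖ = 1) {f x y : H} {l : ℂ} (hl : ‖l‖ ≤ 1)
    (hx : x - l • V x = f) (hy : y - l • V (y - (a * inner ℂ b y) • b) = f) :
    ‖l‖ ^ 2 * (2 * (a * inner ℂ b y * conj (inner ℂ b x)).re) ≤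
      4 * (inner ℂ f x).re + 4 * (inner ℂ f y).re - 4 * ‖f‖ ^ 2 := by
  have hx' : x - f = l • V x := by rw [← hx]; abel
  have hy' : y - f = l • V (y - (a * inner ℂ b y) • b) := by rw [← hy]; abel
  have e1 : ‖x - f‖ ^ 2 = ‖l‖ ^ 2 * ‖x‖ ^ 2 := by
    rw [hx', norm_smul, V.norm_map, mul_pow]
  have e2 : ‖y - f‖ ^ 2 ≤ ‖l‖ ^ 2 * ‖y‖ ^ 2 := by
    rw [hy', norm_smul, V.norm_map, mul_pow]
    exact mul_le_mul_of_nonneg_left (norm_sub_smul_inner_smul_le ha hb y) (by positivity)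
  have e3 : inner ℂ (x - f) (y - f) =
      ((‖l‖ ^ 2 : ℝ) : ℂ) * (inner ℂ x y - a * inner ℂ b y * conj (inner ℂ b x)) := by
    rw [hx', hy', inner_smul_left, inner_smul_right, V.inner_map_map, inner_sub_right,
      inner_smul_right, inner_conj_symm, ← mul_assoc, Complex.conj_mul', Complex.ofReal_pow]
  have e3' := congrArg Complex.re e3
  rw [Complex.re_ofReal_mul, Complex.sub_re] at e3'
  simp only [inner_sub_left, inner_sub_right, Complex.sub_re] at e3'
  have hff : (inner ℂ f f).re = ‖f‖ ^ 2 := inner_self_eq_norm_sq (𝕜 := ℂ) f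
  have hxf : (inner ℂ x f).re = (inner ℂ f x).re := inner_re_symm (𝕜 := ℂ) x f
  have hyf : (inner ℂ y f).re = (inner ℂ f y).re := inner_re_symm (𝕜 := ℂ) y f
  have e4 : ‖x + y‖ ^ 2 = ‖x‖ ^ 2 + 2 * (inner ℂ x y).re + ‖y‖ ^ 2 := norm_add_sq (𝕜 := ℂ) x y
  rw [@norm_sub_sq ℂ] at e1 e2
  simp only [RCLike.re_to_complex] at e1 e2
  have hl2 : 0 ≤ 1 - ‖l‖ ^ 2 := by nlinarith [norm_nonneg l]
  nlinarith [mul_nonneg hl2 (sq_nonneg ‖x + y‖)]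

theorem one_le_two_mul_re_inner (V : H →ₗᵢ[ℂ] H) {b p : H} (hb : ‖b‖ = 1) {l : ℂ} (hl : ‖l‖ ≤ 1)
    (hp : p - l • V p = b) : 1 ≤ 2 * (inner ℂ b p).re := by
  have hp' : p - b = l • V p := by rw [← hp]; abel
  have e1 : ‖p - b‖ ^ 2 = ‖l‖ ^ 2 * ‖p‖ ^ 2 := by
    rw [hp', norm_smul, V.norm_map, mul_pow]
  rw [@norm_sub_sq ℂ, hb] at e1
  simp only [RCLike.re_to_complex] at e1
  have h : (inner ℂ p b).re = (inner ℂ b p).re := inner_re_symm (𝕜 := ℂ) p b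
  have hl2 : 0 ≤ 1 - ‖l‖ ^ 2 := by nlinarith [norm_nonneg l]
  nlinarith [mul_nonneg hl2 (sq_nonneg ‖p‖)]

theorem le_re_conj_mul {a s : ℂ} (hs : 1 ≤ 2 * s.re) :
    a.re - ‖a‖ ^ 2 / 2 ≤ (conj a * (1 + a * (s - 1))).re := by
  have : conj a * (1 + a * (s - 1)) = conj a + ((‖a‖ ^ 2 : ℝ) : ℂ) * (s - 1) := by
    rw [Complex.ofReal_pow, ← Complex.conj_mul']; ring
  rw [this, Complex.add_re, Complex.re_ofReal_mul, Complex.conj_re, Complex.sub_re, Complex.one_re]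
  nlinarith [sq_nonneg ‖a‖]

/-- The weighted estimate with the weight in its harmonic form `2 Re (a / D)`. -/
theorem norm_sq_mul_re_div_le (V : H →ₗᵢ[ℂ] H) {a : ℂ} (ha : ‖a‖ ^ 2 < 2 * a.re)
    {b : H} (hb : ‖b‖ = 1) {f x p : H} {l : ℂ} (hl : ‖l‖ ≤ 1)
    (hx : x - l • V x = f) (hp : p - l • V p = b) :
    ‖l‖ ^ 2 * (‖inner ℂ b x‖ ^ 2 * (2 * (a / (1 + a * (inner ℂ b p - 1))).re)) ≤
      4 * (inner ℂ f x + (inner ℂ f x - a * (inner ℂ b x / (1 + a * (inner ℂ b p - 1))) *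
        (inner ℂ f p - inner ℂ f b))).re - 4 * ‖f‖ ^ 2 := by
  have hD : 1 + a * (inner ℂ b p - 1) ≠ 0 := by
    intro h
    have := le_re_conj_mul (a := a) (one_le_two_mul_re_inner V hb hl hp)
    rw [h, mul_zero, Complex.zero_re] at this
    linarith
  set D := 1 + a * (inner ℂ b p - 1) with hDdef
  set h := inner ℂ b x / D with hh
  have hbb : inner ℂ b b = 1 := by rw [inner_self_eq_norm_sq_to_K, hb]; simp
  obtain ⟨y, rfl⟩ : ∃ y, y = x - (a * h) • (p - b) := ⟨_, rfl⟩
  have hby : inner ℂ b (x - (a * h) • (p - b)) = h := by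
    have : inner ℂ b x = h * D := by rw [hh]; field_simp
    rw [inner_sub_right, inner_smul_right, inner_sub_right, hbb, this, hDdef]
    ring
  have key := re_inner_mul_conj_inner_le V ha.le hb (f := f) (x := x)
    (y := x - (a * h) • (p - b)) hl hx (by
      rw [hby]
      have e : b - p = -(l • V p) := by rw [← hp]; abel
      have e' : x = f + l • V x := by rw [← hx]; abel
      have e'' : p - b = l • V p := by rw [← hp]; abel
      simp only [map_sub, map_smul, smul_sub]
      rw [smul_comm l (a * h) (V p), ← e'']
      nth_rewrite 1 [e']
      module)
  rw [hby, inner_sub_right, inner_smul_right, inner_sub_right] at key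
  have e5 : (a * h * conj (inner ℂ b x)).re = ‖inner ℂ b x‖ ^ 2 * (a / D).re := by
    rw [← Complex.re_ofReal_mul, Complex.ofReal_pow, ← Complex.mul_conj', hh]
    congr 1; ring
  rw [e5] at key
  rw [Complex.add_re]
  linarith

variable [CompleteSpace H]

theorem isUnit_one_sub_smul (V : H →ₗᵢ[ℂ] H) {l : ℂ} (hl : ‖l‖ < 1) :
    IsUnit (1 - l • V.toContinuousLinearMap) := by
  apply isUnit_one_sub_of_norm_lt_one
  calc ‖l • V.toContinuousLinearMap‖ ≤ ‖l‖ * 1 := by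
        rw [norm_smul]; gcongr; exact V.norm_toContinuousLinearMap_le
    _ < 1 := by simpa

theorem inverse_sub_smul (V : H →ₗᵢ[ℂ] H) {l : ℂ} (hl : ‖l‖ < 1) (f : H) :
    Ring.inverse (1 - l • V.toContinuousLinearMap) f -
      l • V (Ring.inverse (1 - l • V.toContinuousLinearMap) f) = f := by
  simpa using congrArg (fun A : H →L[ℂ] H => A f)
    (Ring.mul_inverse_cancel _ (isUnit_one_sub_smul V hl))

theorem differentiableAt_inner_inverse (V : H →ₗᵢ[ℂ] H) {l : ℂ} (hl : ‖l‖ < 1) (g f : H) :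
    DifferentiableAt ℂ
      (fun l : ℂ => inner ℂ g (Ring.inverse (1 - l • V.toContinuousLinearMap) f)) l := by
  have h1 : DifferentiableAt ℂ
      (fun l : ℂ => Ring.inverse (1 - l • V.toContinuousLinearMap)) l :=
    (differentiableAt_inverse (𝕜 := ℂ) (isUnit_one_sub_smul V hl)).comp (f := fun l : ℂ =>
      (1 - l • V.toContinuousLinearMap : H →L[ℂ] H)) l
      ((differentiableAt_const _).sub (differentiableAt_id.smul_const _))
  exact (innerSL ℂ g).differentiableAt.comp l (h1.clm_apply (differentiableAt_const f))
end Abstract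

section CircleMeasure

theorem map_exp_univ : Measure.map (fun t : ℝ => Complex.exp (t * Complex.I))
      (volume.restrict (Set.Ioc 0 (2 * Real.pi))) Set.univ = ENNReal.ofReal (2 * Real.pi) := by
  rw [Measure.map_apply (by fun_prop) MeasurableSet.univ]
  simp

instance : IsProbabilityMeasure circleMeasure := by
  constructor
  rw [circleMeasure, Measure.smul_apply, map_exp_univ, smul_eq_mul,
    ← ENNReal.ofReal_mul (by positivity), inv_mul_cancel₀ (by positivity), ENNReal.ofReal_one]

theorem ae_circleMeasure_norm_eq_one : ∀ᵐ z ∂circleMeasure, ‖z‖ = 1 := by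
  refine Measure.ae_smul_measure ?_ _
  rw [ae_map_iff (by fun_prop) (measurableSet_eq_fun (by fun_prop) (by fun_prop))]
  exact ae_of_all _ fun t => Complex.norm_exp_ofReal_mul_I t

theorem aestronglyMeasurable_circleMeasure {E : Type*} [NormedAddCommGroup E] {f : ℂ → E}
    (hf : ContinuousOn f (sphere 0 1)) : AEStronglyMeasurable f circleMeasure := by
  have h : circleMeasure.restrict (sphere (0 : ℂ) 1) = circleMeasure :=
    Measure.restrict_eq_self_of_ae_mem (by simpa using ae_circleMeasure_norm_eq_one)
  rw [← h]
  exact hf.aestronglyMeasurable_of_isCompact (isCompact_sphere 0 1) isClosed_sphere.measurableSet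

theorem integrable_circleMeasure {E : Type*} [NormedAddCommGroup E] {f : ℂ → E}
    (hf : ContinuousOn f (sphere 0 1)) : Integrable f circleMeasure := by
  obtain ⟨C, hC⟩ := (isCompact_sphere (0 : ℂ) 1).exists_bound_of_continuousOn hf
  refine Integrable.of_bound (aestronglyMeasurable_circleMeasure hf) C ?_
  filter_upwards [ae_circleMeasure_norm_eq_one] with z hz using hC z (by simpa using hz)

theorem integral_circleMeasure {E : Type*} [NormedAddCommGroup E] [NormedSpace ℝ E] {f : ℂ → E}
    (hf : AEStronglyMeasurable f circleMeasure) :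
    ∫ z, f z ∂circleMeasure = Real.circleAverage f 0 1 := by
  have h0 : ENNReal.ofReal (2 * Real.pi)⁻¹ ≠ 0 := by
    simpa using Real.pi_pos
  have hf' := hf.mono_ac (Measure.absolutelyContinuous_smul h0)
  rw [circleMeasure, integral_smul_measure, integral_map (by fun_prop) hf',
    ENNReal.toReal_ofReal (by positivity), Real.circleAverage_def,
    intervalIntegral.integral_of_le (by positivity)]
  simp [circleMap]

theorem integral_circleMeasure_mul {g : ℂ → ℂ} (hg : ∀ l, ‖l‖ < 1 → DifferentiableAt ℂ g l)
    {s : ℝ} (hs0 : 0 ≤ s) (hs : s < 1) :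
    Integrable (fun z : ℂ => g (s * z)) circleMeasure ∧
      ∫ z, g (s * z) ∂circleMeasure = g 0 := by
  have hd : ∀ z : ℂ, ‖z‖ ≤ 1 → DifferentiableAt ℂ (fun z : ℂ => g (s * z)) z := by
    intro z hz
    refine DifferentiableAt.comp (f := fun z : ℂ => (s : ℂ) * z) z (hg _ ?_) (by fun_prop)
    rw [norm_mul, Complex.norm_real, Real.norm_of_nonneg hs0]
    nlinarith [norm_nonneg z]
  have hc : ContinuousOn (fun z : ℂ => g (s * z)) (sphere 0 1) := fun z hz =>
    (hd z (by simpa using (mem_sphere_zero_iff_norm.1 hz).le)).continuousAt.continuousWithinAt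
  refine ⟨integrable_circleMeasure hc, ?_⟩
  rw [integral_circleMeasure (aestronglyMeasurable_circleMeasure hc),
    circleAverage_of_differentiable_on_off_countable (s := ∅) Set.countable_empty]
  · simp
  · exact fun z hz => (hd z (by simpa using hz)).continuousAt.continuousWithinAt
  · exact fun z hz => hd z (by simpa using (mem_ball_zero_iff.1 hz.1).le)

end CircleMeasure

section Weight

theorem sq_norm_lt_two_mul_re {γ : ℂ} (hγ : ‖γ‖ < 1) :
    ‖1 - conj γ‖ ^ 2 < 2 * (1 - conj γ).re := by
  have h : ‖γ‖ ^ 2 < 1 := by nlinarith [norm_nonneg γ]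
  rw [← Complex.normSq_eq_norm_sq, Complex.normSq_apply] at h ⊢
  simp
  nlinarith

theorem norm_le_one_of_eq {γ s : ℂ} (hγ : ‖γ‖ < 1) (hs : 0 ≤ 1 + 2 * s.re)
    (hD : 1 + (1 - conj γ) * s ≠ 0) :
    ‖-γ + (1 - (‖γ‖ : ℂ) ^ 2) * s / (1 + (1 - conj γ) * s)‖ ^ 2 ≤ 1 := by
  have h : ‖γ‖ ^ 2 < 1 := by nlinarith [norm_nonneg γ]
  have e : -γ + (1 - (‖γ‖ : ℂ) ^ 2) * s / (1 + (1 - conj γ) * s) =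
      ((1 - γ) * s - γ) / (1 + (1 - conj γ) * s) := by
    rw [← Complex.mul_conj', eq_div_iff hD, add_mul, div_mul_cancel₀ _ hD]
    ring
  rw [e, norm_div, div_pow, div_le_one (by positivity)]
  have : ‖1 + (1 - conj γ) * s‖ ^ 2 - ‖(1 - γ) * s - γ‖ ^ 2 = (1 - ‖γ‖ ^ 2) * (1 + 2 * s.re) := by
    simp only [← Complex.normSq_eq_norm_sq, Complex.normSq_apply]
    simp
    ring
  nlinarith [mul_nonneg (sub_nonneg.2 h.le) hs]

/-- Inside the disc the weight is the harmonic function `2 Re (a / D)`. -/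
theorem vWeight_thetaG {γ : ℂ} (hγ : ‖γ‖ < 1) {μ : Measure ℂ} {Θ : ℂ → ℂ} {z l : ℂ}
    (hΘ : Θ z = thetaG γ μ l) (hs : 0 ≤ 1 + 2 * (R1t μ l).re)
    (hD : 1 + (1 - conj γ) * R1t μ l ≠ 0) :
    vWeight γ Θ z = 2 * ((1 - conj γ) / (1 + (1 - conj γ) * R1t μ l)).re := by
  have h : 0 < 1 - ‖γ‖ ^ 2 := by nlinarith [norm_nonneg γ]
  have hle := norm_le_one_of_eq hγ hs hD
  rw [thetaG] at hΘ
  rw [← hΘ] at hle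
  set t := Θ z
  set s := R1t μ l
  have e1 : vWeight γ Θ z = (1 - ‖γ‖ ^ 2)⁻¹ *
      (‖1 + (conj γ - 1) * t - γ‖ ^ 2 + ‖conj γ - 1‖ ^ 2 * (1 - ‖t‖ ^ 2)) := by
    rw [vWeight, BgammaFst, BgammaSnd]
    simp only [norm_mul, mul_pow, norm_inv, Complex.norm_real, inv_pow, Real.norm_eq_abs, sq_abs]
    rw [Real.sq_sqrt h.le, Real.sq_sqrt (by linarith)]
    ring
  have e2 : ‖1 + (conj γ - 1) * t - γ‖ ^ 2 + ‖conj γ - 1‖ ^ 2 * (1 - ‖t‖ ^ 2) =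
      2 * ((1 - conj γ) * (1 - γ) - (1 - conj γ) ^ 2 * t).re := by
    simp only [← Complex.normSq_eq_norm_sq, Complex.normSq_apply]
    rw [pow_two (1 - conj γ)]
    simp
    ring
  have e3 : (1 - conj γ) * (1 - γ) - (1 - conj γ) ^ 2 * t =
      ((1 - ‖γ‖ ^ 2 : ℝ) : ℂ) * ((1 - conj γ) / (1 + (1 - conj γ) * s)) := by
    rw [hΘ]
    push_cast
    rw [← Complex.mul_conj']
    field_simp
    ring
  rw [e1, e2, e3, Complex.re_ofReal_mul]
  field_simp

theorem re_div_le {γ D : ℂ} (hγ : ‖γ‖ < 1)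
    (hD : (1 - conj γ).re - ‖1 - conj γ‖ ^ 2 / 2 ≤ (conj (1 - conj γ) * D).re) :
    ((1 - conj γ) / D).re ≤
      ‖1 - conj γ‖ ^ 2 / ((1 - conj γ).re - ‖1 - conj γ‖ ^ 2 / 2) := by
  set a := 1 - conj γ
  have ha : 0 < a.re - ‖a‖ ^ 2 / 2 := by linarith [sq_norm_lt_two_mul_re hγ]
  have ha0 : 0 < ‖a‖ := norm_pos_iff.2 (by rintro h; simp [h] at ha)
  calc (a / D).re ≤ ‖a / D‖ := Complex.re_le_norm _
    _ = ‖a‖ ^ 2 / ‖conj a * D‖ := by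
      rw [norm_div, norm_mul, Complex.norm_conj]; field_simp
    _ ≤ _ := by
      gcongr
      exact hD.trans (Complex.re_le_norm _)

end Weight

section CauchyOperator

/-- The integral operator `(T_r f)(z) = ∫ f(ξ)/(1-rξ̄z) dμ(ξ)`. -/
def cauchyOp (μ : Measure ℂ) (r : ℝ) (f : ℂ → ℂ) (z : ℂ) : ℂ :=
  ∫ ξ, f ξ / (1 - (r : ℂ) * conj ξ * z) ∂μ

theorem exists_linearIsometry_mul (μ : Measure ℂ) {u : ℂ → ℂ} (hu : Measurable u)
    (h1 : ∀ᵐ ξ ∂μ, ‖u ξ‖ = 1) :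
    ∃ V : Lp ℂ 2 μ →ₗᵢ[ℂ] Lp ℂ 2 μ, ∀ f, V f =ᵐ[μ] fun ξ => u ξ * f ξ := by
  have hm : ∀ f : Lp ℂ 2 μ, MemLp (fun ξ => u ξ * f ξ) 2 μ := fun f => by
    refine (Lp.memLp f).of_le
      (hu.aestronglyMeasurable.mul (Lp.memLp f).aestronglyMeasurable) ?_
    filter_upwards [h1] with ξ hξ
    simp [hξ]
  refine ⟨{ toFun := fun f => (hm f).toLp _, map_add' := ?_, map_smul' := ?_, norm_map' := ?_ },
    fun f => (hm f).coeFn_toLp⟩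
  · intro f g
    apply Lp.ext
    filter_upwards [(hm (f + g)).coeFn_toLp, (hm f).coeFn_toLp, (hm g).coeFn_toLp,
      Lp.coeFn_add f g, Lp.coeFn_add ((hm f).toLp _) ((hm g).toLp _)] with ξ h1 h2 h3 h4 h5
    rw [h1, h5, Pi.add_apply, h2, h3, h4, Pi.add_apply, mul_add]
  · intro c f
    apply Lp.ext
    filter_upwards [(hm (c • f)).coeFn_toLp, (hm f).coeFn_toLp,
      Lp.coeFn_smul c f, Lp.coeFn_smul c ((hm f).toLp _)] with ξ h1 h2 h3 h4
    rw [h1, RingHom.id_apply, h4, Pi.smul_apply, h2, h3, Pi.smul_apply, smul_eq_mul, smul_eq_mul,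
      mul_left_comm]
  · intro f
    change ‖(hm f).toLp _‖ = ‖f‖
    rw [Lp.norm_toLp, Lp.norm_def]
    congr 1
    refine eLpNorm_congr_norm_ae ?_
    filter_upwards [h1] with ξ hξ
    simp [hξ]

theorem one_sub_ne_zero_of_norm_lt_one {w : ℂ} (h : ‖w‖ < 1) : 1 - w ≠ 0 := by
  intro h0
  rw [← sub_eq_zero.1 h0] at h
  simp at h

theorem inverse_ae_eq {μ : Measure ℂ} (hμ : ∀ᵐ ξ ∂μ, ‖ξ‖ = 1) {V : Lp ℂ 2 μ →ₗᵢ[ℂ] Lp ℂ 2 μ}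
    (hV : ∀ f, V f =ᵐ[μ] fun ξ => conj ξ * f ξ) {l : ℂ} (hl : ‖l‖ < 1) (f : Lp ℂ 2 μ) :
    Ring.inverse (1 - l • V.toContinuousLinearMap) f =ᵐ[μ]
      fun ξ => f ξ / (1 - conj ξ * l) := by
  have h := inverse_sub_smul V hl f
  set x := Ring.inverse (1 - l • V.toContinuousLinearMap) f
  filter_upwards [hμ, hV x, Lp.coeFn_smul l (V x), Lp.coeFn_sub x (l • V x)] with ξ h1 h2 h3 h4
  have hne : 1 - conj ξ * l ≠ 0 := one_sub_ne_zero_of_norm_lt_one (by simpa [h1] using hl)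
  rw [h] at h4
  rw [eq_div_iff hne, h4, Pi.sub_apply, h3, Pi.smul_apply, h2, smul_eq_mul]
  ring

variable {μ : Measure ℂ} [IsProbabilityMeasure μ]

variable (μ) in
/-- The constant function `1` as an element of `L²(μ)`. -/
def constOne : Lp ℂ 2 μ := (memLp_const (1 : ℂ)).toLp _

theorem norm_constOne : ‖constOne μ‖ = 1 := by
  rw [constOne, Lp.norm_toLp, eLpNorm_const _ (by simp) (NeZero.ne μ)]
  simp

theorem inner_constOne (f : Lp ℂ 2 μ) : inner ℂ (constOne μ) f = ∫ ξ, f ξ ∂μ := by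
  rw [L2.inner_def]
  refine integral_congr_ae ?_
  filter_upwards [(memLp_const (1 : ℂ)).coeFn_toLp (μ := μ) (p := 2)] with ξ h
  rw [constOne, h]
  simp

theorem integral_inverse_eq (hμ : ∀ᵐ ξ ∂μ, ‖ξ‖ = 1) {V : Lp ℂ 2 μ →ₗᵢ[ℂ] Lp ℂ 2 μ}
    (hV : ∀ f, V f =ᵐ[μ] fun ξ => conj ξ * f ξ) {l : ℂ} (hl : ‖l‖ < 1) (f : Lp ℂ 2 μ) :
    inner ℂ (constOne μ) (Ring.inverse (1 - l • V.toContinuousLinearMap) f) =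
      ∫ ξ, f ξ / (1 - conj ξ * l) ∂μ := by
  rw [inner_constOne, integral_congr_ae (inverse_ae_eq hμ hV hl f)]

theorem cauchyOp_eq_inner (hμ : ∀ᵐ ξ ∂μ, ‖ξ‖ = 1) {V : Lp ℂ 2 μ →ₗᵢ[ℂ] Lp ℂ 2 μ}
    (hV : ∀ f, V f =ᵐ[μ] fun ξ => conj ξ * f ξ) {s : ℝ} {z : ℂ} (hl : ‖(s : ℂ) * z‖ < 1)
    (f : Lp ℂ 2 μ) :
    cauchyOp μ s f z =
      inner ℂ (constOne μ) (Ring.inverse (1 - ((s : ℂ) * z) • V.toContinuousLinearMap) f) := by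
  rw [integral_inverse_eq hμ hV hl, cauchyOp]
  congr! 4
  ring

theorem R1t_eq_inner (hμ : ∀ᵐ ξ ∂μ, ‖ξ‖ = 1) {V : Lp ℂ 2 μ →ₗᵢ[ℂ] Lp ℂ 2 μ}
    (hV : ∀ f, V f =ᵐ[μ] fun ξ => conj ξ * f ξ) {l : ℂ} (hl : ‖l‖ < 1) :
    R1t μ l = inner ℂ (constOne μ)
      (Ring.inverse (1 - l • V.toContinuousLinearMap) (constOne μ)) - 1 := by
  set x := Ring.inverse (1 - l • V.toContinuousLinearMap) (constOne μ) with hx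
  have h1 : Integrable x μ := (Lp.memLp x).integrable (by norm_num)
  have h2 : (1 : ℂ) = ∫ _, (1 : ℂ) ∂μ := by simp
  rw [inner_constOne, h2, ← integral_sub h1 (integrable_const _), R1t]
  refine integral_congr_ae ?_
  filter_upwards [hμ, inverse_ae_eq hμ hV hl (constOne μ),
    (memLp_const (1 : ℂ)).coeFn_toLp (μ := μ) (p := 2)] with ξ h3 h4 h5
  have hne : 1 - conj ξ * l ≠ 0 := one_sub_ne_zero_of_norm_lt_one (by simpa [h3] using hl)
  rw [hx, h4, constOne, h5]
  field_simp
  ring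

theorem zero_le_one_add_two_mul_re_R1t (hμ : ∀ᵐ ξ ∂μ, ‖ξ‖ = 1) {l : ℂ} (hl : ‖l‖ < 1) :
    0 ≤ 1 + 2 * (R1t μ l).re := by
  obtain ⟨V, hV⟩ := exists_linearIsometry_mul μ (u := fun ξ => conj ξ) (by fun_prop) (by simpa)
  rw [R1t_eq_inner hμ hV hl]
  have := one_le_two_mul_re_inner V norm_constOne hl.le (inverse_sub_smul V hl (constOne μ))
  simp only [Complex.sub_re, Complex.one_re]
  linarith

theorem le_re_conj_mul_R1t (hμ : ∀ᵐ ξ ∂μ, ‖ξ‖ = 1) {l : ℂ} (hl : ‖l‖ < 1) (a : ℂ) :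
    a.re - ‖a‖ ^ 2 / 2 ≤ (conj a * (1 + a * R1t μ l)).re := by
  have h := zero_le_one_add_two_mul_re_R1t hμ hl
  have := le_re_conj_mul (a := a) (s := R1t μ l + 1) (by simp; linarith)
  simpa using this

theorem vWeight_eq (hμ : ∀ᵐ ξ ∂μ, ‖ξ‖ = 1) {γ : ℂ} (hγ : ‖γ‖ < 1) {Θ : ℂ → ℂ} {z l : ℂ}
    (hl : ‖l‖ < 1) (hΘ : Θ z = thetaG γ μ l) :
    vWeight γ Θ z = 2 * ((1 - conj γ) / (1 + (1 - conj γ) * R1t μ l)).re := by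
  refine vWeight_thetaG hγ hΘ (zero_le_one_add_two_mul_re_R1t hμ hl) fun h => ?_
  have := le_re_conj_mul_R1t hμ hl (1 - conj γ)
  rw [h, mul_zero, Complex.zero_re] at this
  linarith [sq_norm_lt_two_mul_re hγ]

theorem norm_ofReal_mul_lt_one {s : ℝ} (hs0 : 0 ≤ s) (hs : s < 1) {z : ℂ} (hz : ‖z‖ = 1) :
    ‖(s : ℂ) * z‖ < 1 := by
  simpa [hz, abs_of_nonneg hs0] using hs

theorem lintegral_cauchyOp_sq_le (hμ : ∀ᵐ ξ ∂μ, ‖ξ‖ = 1) {γ : ℂ} (hγ : ‖γ‖ < 1)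
    {s : ℝ} (hs0 : 0 < s) (hs : s < 1) (f : Lp ℂ 2 μ) :
    ∫⁻ z, ENNReal.ofReal (‖cauchyOp μ s f z‖ ^ 2 *
      vWeight γ (fun z => thetaG γ μ (s * z)) z) ∂circleMeasure ≤
      ENNReal.ofReal ((2 / s * ‖f‖) ^ 2) := by
  obtain ⟨V, hV⟩ := exists_linearIsometry_mul μ (u := fun ξ => conj ξ) (by fun_prop) (by simpa)
  set a := 1 - conj γ
  have ha2 := sq_norm_lt_two_mul_re hγ
  let X : ℂ → Lp ℂ 2 μ →L[ℂ] Lp ℂ 2 μ := fun l => Ring.inverse (1 - l • V.toContinuousLinearMap)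
  let b := constOne μ
  let D : ℂ → ℂ := fun l => 1 + a * (inner ℂ b (X l b) - 1)
  let g : ℂ → ℂ := fun l => inner ℂ f (X l f) + (inner ℂ f (X l f) -
    a * (inner ℂ b (X l f) / D l) * (inner ℂ f (X l b) - inner ℂ f b))
  have hD : ∀ l, ‖l‖ < 1 → D l ≠ 0 := fun l hl h0 => by
    have h := le_re_conj_mul_R1t hμ hl a
    rw [R1t_eq_inner hμ hV hl] at h
    change 1 + a * (inner ℂ b (X l b) - 1) = 0 at h0
    change _ ≤ (_ * (1 + a * (inner ℂ b (X l b) - 1))).re at h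
    rw [h0, mul_zero, Complex.zero_re] at h
    linarith
  have hg : ∀ l, ‖l‖ < 1 → DifferentiableAt ℂ g l := fun l hl => by
    have hd := differentiableAt_inner_inverse V hl
    refine (hd f f).add ((hd f f).sub (DifferentiableAt.mul (((hd b f).div ?_ (hD l hl)).const_mul a)
      ((hd f b).sub_const _)))
    exact (((hd b b).sub_const 1).const_mul a).const_add 1
  have hg0 : g 0 = 2 * ((‖f‖ ^ 2 : ℝ) : ℂ) := by
    simp only [g, X, zero_smul, sub_zero, Ring.inverse_one, one_apply_eq_self,
      sub_self, mul_zero]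
    rw [inner_self_eq_norm_sq_to_K]
    push_cast
    simp
    ring
  obtain ⟨hint, hval⟩ := integral_circleMeasure_mul hg hs0.le hs
  have hre : Integrable (fun z : ℂ => (g (s * z)).re) circleMeasure := hint.re
  let G : ℂ → ℝ := fun z => (4 * (g (s * z)).re - 4 * ‖f‖ ^ 2) / s ^ 2
  have hGi : Integrable G circleMeasure := ((hre.const_mul 4).sub (integrable_const _)).div_const _
  have hGv : ∫ z, G z ∂circleMeasure = (2 / s * ‖f‖) ^ 2 := by
    have h1 : ∫ z : ℂ, (g (s * z)).re ∂circleMeasure = 2 * ‖f‖ ^ 2 := by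
      have : ∫ z : ℂ, (g (s * z)).re ∂circleMeasure = (∫ z : ℂ, g (s * z) ∂circleMeasure).re :=
        integral_re hint
      rw [this, hval, hg0, mul_comm, Complex.re_ofReal_mul]
      simp
      ring
    rw [integral_div, integral_sub (hre.const_mul 4) (integrable_const _), integral_const_mul, h1]
    simp
    field_simp
    ring
  have hle : ∀ᵐ z ∂circleMeasure, 0 ≤ ‖cauchyOp μ s f z‖ ^ 2 *
      vWeight γ (fun z => thetaG γ μ (s * z)) z ∧ ‖cauchyOp μ s f z‖ ^ 2 *
      vWeight γ (fun z => thetaG γ μ (s * z)) z ≤ G z := by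
    filter_upwards [ae_circleMeasure_norm_eq_one] with z hz
    have hl := norm_ofReal_mul_lt_one hs0.le hs hz
    have h := norm_sq_mul_re_div_le V ha2 (norm_constOne (μ := μ)) hl.le (inverse_sub_smul V hl f)
      (inverse_sub_smul V hl (constOne μ))
    refine ⟨by rw [vWeight]; positivity, ?_⟩
    rw [vWeight_eq (Θ := fun z => thetaG γ μ (s * z)) hμ hγ hl rfl, R1t_eq_inner hμ hV hl,
      cauchyOp_eq_inner hμ hV hl,
      le_div_iff₀ (by positivity), mul_comm]
    rw [norm_mul, hz, mul_one, Complex.norm_real, Real.norm_of_nonneg hs0.le] at h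
    exact h
  calc _ ≤ ∫⁻ z, ENNReal.ofReal (G z) ∂circleMeasure := by
        refine lintegral_mono_ae ?_
        filter_upwards [hle] with z hz using ENNReal.ofReal_le_ofReal hz.2
    _ = ENNReal.ofReal (∫ z, G z ∂circleMeasure) := by
        rw [ofReal_integral_eq_lintegral_ofReal hGi]
        filter_upwards [hle] with z hz using hz.1.trans hz.2
    _ = _ := by rw [hGv]

end CauchyOperator

section Iteration

theorem le_of_iterate {E : Type*} [NormedAddCommGroup E] {φ : E → ℝ} {V : E → E}
    (hV : ∀ f, ‖V f‖ = ‖f‖) {K p q δ : ℝ} (hp : 0 ≤ p) (hpq : p < q) (hδ : 0 ≤ δ)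
    (hK : ∀ f, φ f ≤ K * ‖f‖) (h : ∀ f, q * φ f ≤ p * φ (V f) + δ * ‖f‖) (f : E) :
    φ f ≤ δ / (q - p) * ‖f‖ := by
  have hq : 0 < q := hp.trans_lt hpq
  have hqp : 0 < q - p := sub_pos.2 hpq
  have hn : ∀ (n : ℕ) (f : E), φ f ≤ ((p / q) ^ n * K + δ / (q - p)) * ‖f‖ := by
    intro n
    induction n with
    | zero =>
      intro f
      have : 0 ≤ δ / (q - p) * ‖f‖ := by positivity
      nlinarith [hK f]
    | succ n ih =>
      intro f
      have h1 := ih (V f)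
      rw [hV] at h1
      have h2 : q * φ f ≤ p * (((p / q) ^ n * K + δ / (q - p)) * ‖f‖) + δ * ‖f‖ :=
        (h f).trans (by gcongr)
      have h3 : p * (((p / q) ^ n * K + δ / (q - p)) * ‖f‖) + δ * ‖f‖ =
          q * (((p / q) ^ (n + 1) * K + δ / (q - p)) * ‖f‖) := by
        rw [pow_succ]
        field_simp
        ring
      exact le_of_mul_le_mul_left (h3 ▸ h2) hq
  have hlim : Tendsto (fun n : ℕ => ((p / q) ^ n * K + δ / (q - p)) * ‖f‖) atTop
      (𝓝 ((0 * K + δ / (q - p)) * ‖f‖)) :=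
    (((tendsto_pow_atTop_nhds_zero_of_lt_one (by positivity)
      ((div_lt_one hq).2 hpq)).mul_const K).add_const _).mul_const _
  have := ge_of_tendsto' hlim fun n => hn n f
  simpa using this

theorem lpNorm_le_of_ae_norm_le {α E : Type*} [MeasurableSpace α] [NormedAddCommGroup E]
    {ν : Measure α} {p : ℝ≥0∞} (hp : 1 ≤ p) {A B C : α → E} (hB : MemLp B p ν) (hC : MemLp C p ν)
    {c d : ℝ} (hc : 0 ≤ c) (hd : 0 ≤ d) (h : ∀ᵐ z ∂ν, ‖A z‖ ≤ c * ‖B z‖ + d * ‖C z‖) :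
    lpNorm A p ν ≤ c * lpNorm B p ν + d * lpNorm C p ν := by
  by_cases hA : AEStronglyMeasurable A ν
  swap
  · rw [lpNorm_of_not_aestronglyMeasurable hA]
    exact add_nonneg (mul_nonneg hc lpNorm_nonneg) (mul_nonneg hd lpNorm_nonneg)
  have hB' : MemLp (c • fun z => ‖B z‖) p ν := hB.norm.const_smul c
  have hC' : MemLp (d • fun z => ‖C z‖) p ν := hC.norm.const_smul d
  calc lpNorm A p ν ≤ lpNorm ((c • fun z => ‖B z‖) + d • fun z => ‖C z‖) p ν := by
        rw [← toReal_eLpNorm hA, ← toReal_eLpNorm (hB'.add hC').aestronglyMeasurable]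
        refine ENNReal.toReal_mono (hB'.add hC').eLpNorm_ne_top (eLpNorm_mono_ae_real ?_)
        filter_upwards [h] with z hz using by simpa using hz
    _ ≤ lpNorm (c • fun z => ‖B z‖) p ν + lpNorm (d • fun z => ‖C z‖) p ν := lpNorm_add_le hB' hp
    _ = _ := by
      rw [lpNorm_const_smul, lpNorm_const_smul, lpNorm_norm hB.1, lpNorm_norm hC.1]
      simp [abs_of_nonneg hc, abs_of_nonneg hd]

end Iteration

section UniformBound

variable {μ : Measure ℂ} [IsProbabilityMeasure μ]

theorem measurable_cauchyOp (r : ℝ) {f : ℂ → ℂ} (hf : Measurable f) :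
    Measurable (cauchyOp μ r f) := by
  refine (StronglyMeasurable.integral_prod_right (ν := μ)
    (f := fun z ξ => f ξ / (1 - (r : ℂ) * conj ξ * z)) ?_).measurable
  apply Measurable.stronglyMeasurable
  unfold Function.uncurry
  fun_prop

theorem measurable_R1t : Measurable (R1t μ) := by
  refine (StronglyMeasurable.integral_prod_right (ν := μ)
    (f := fun l ξ => (conj ξ * l) / (1 - conj ξ * l)) ?_).measurable
  apply Measurable.stronglyMeasurable
  unfold Function.uncurry
  fun_prop

theorem measurable_vWeight {γ : ℂ} {Θ : ℂ → ℂ} (hΘ : Measurable Θ) :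
    Measurable (vWeight γ Θ) := by
  unfold vWeight BgammaFst BgammaSnd
  fun_prop

theorem measurable_vWeight_thetaG (γ : ℂ) (s : ℝ) :
    Measurable (vWeight γ (fun z => thetaG γ μ (s * z))) := by
  refine measurable_vWeight ?_
  have h : Measurable fun z : ℂ => R1t μ (s * z) := measurable_R1t.comp (by fun_prop)
  unfold thetaG
  fun_prop

theorem abs_one_sub_le_norm {r : ℝ} (hr : 0 ≤ r) {ξ z : ℂ} (hξ : ‖ξ‖ = 1) (hz : ‖z‖ = 1) :
    |1 - r| ≤ ‖1 - (r : ℂ) * conj ξ * z‖ := by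
  have := abs_norm_sub_norm_le (1 : ℂ) ((r : ℂ) * conj ξ * z)
  simpa [hξ, hz, abs_of_nonneg hr] using this

theorem integral_norm_le_norm (f : Lp ℂ 2 μ) : ∫ ξ, ‖f ξ‖ ∂μ ≤ ‖f‖ := by
  rw [← lpNorm_one_eq_integral_norm (Lp.memLp f).1, Lp.norm_def,
    ← toReal_eLpNorm (Lp.memLp f).1]
  exact ENNReal.toReal_mono (Lp.memLp f).2.ne
    (eLpNorm_le_eLpNorm_of_exponent_le (by norm_num) (Lp.memLp f).1)

theorem norm_cauchyOp_le (hμ : ∀ᵐ ξ ∂μ, ‖ξ‖ = 1) {r : ℝ} (hr : 0 ≤ r) (hr1 : r ≠ 1)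
    (f : Lp ℂ 2 μ) {z : ℂ} (hz : ‖z‖ = 1) : ‖cauchyOp μ r f z‖ ≤ |1 - r|⁻¹ * ‖f‖ := by
  have h0 : 0 < |1 - r| := abs_pos.2 (sub_ne_zero.2 hr1.symm)
  have hi : Integrable (fun ξ => |1 - r|⁻¹ * ‖f ξ‖) μ :=
    ((Lp.memLp f).integrable (by norm_num)).norm.const_mul _
  calc ‖cauchyOp μ r f z‖ ≤ ∫ ξ, |1 - r|⁻¹ * ‖f ξ‖ ∂μ := by
        refine norm_integral_le_of_norm_le hi ?_
        filter_upwards [hμ] with ξ hξ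
        rw [norm_div, div_eq_inv_mul]
        gcongr
        exact abs_one_sub_le_norm hr hξ hz
    _ ≤ _ := by
      rw [integral_const_mul]
      gcongr
      exact integral_norm_le_norm f

theorem integrable_div (hμ : ∀ᵐ ξ ∂μ, ‖ξ‖ = 1) {r : ℝ} (hr : 0 ≤ r) (hr1 : r ≠ 1)
    (f : Lp ℂ 2 μ) {z : ℂ} (hz : ‖z‖ = 1) :
    Integrable (fun ξ => f ξ / (1 - (r : ℂ) * conj ξ * z)) μ := by
  have h0 : 0 < |1 - r| := abs_pos.2 (sub_ne_zero.2 hr1.symm)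
  have hi : Integrable (fun ξ => |1 - r|⁻¹ * ‖f ξ‖) μ :=
    ((Lp.memLp f).integrable (by norm_num)).norm.const_mul _
  refine hi.mono' ?_ ?_
  · exact ((Lp.memLp f).1.aemeasurable.div (by fun_prop : Measurable fun ξ : ℂ =>
      1 - (r : ℂ) * conj ξ * z).aemeasurable).aestronglyMeasurable
  · filter_upwards [hμ] with ξ hξ
    rw [norm_div, div_eq_inv_mul]
    gcongr
    exact abs_one_sub_le_norm hr hξ hz

theorem memLp_cauchyOp (hμ : ∀ᵐ ξ ∂μ, ‖ξ‖ = 1) {r : ℝ} (hr : 0 ≤ r) (hr1 : r ≠ 1)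
    (f : Lp ℂ 2 μ) {ν : Measure ℂ} [IsFiniteMeasure ν] (hν : ν ≪ circleMeasure) :
    MemLp (cauchyOp μ r f) 2 ν := by
  refine MemLp.of_bound (measurable_cauchyOp r (Lp.stronglyMeasurable f).measurable
    ).aestronglyMeasurable (|1 - r|⁻¹ * ‖f‖) ?_
  filter_upwards [hν.ae_le ae_circleMeasure_norm_eq_one] with z hz
    using norm_cauchyOp_le hμ hr hr1 f hz

theorem lpNorm_cauchyOp_le (hμ : ∀ᵐ ξ ∂μ, ‖ξ‖ = 1) {r : ℝ} (hr : 0 ≤ r) (hr1 : r ≠ 1)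
    (f : Lp ℂ 2 μ) {ν : Measure ℂ} [IsFiniteMeasure ν] (hν : ν ≪ circleMeasure) :
    lpNorm (cauchyOp μ r f) 2 ν ≤ |1 - r|⁻¹ * ν.real Set.univ ^ (2 : ℝ)⁻¹ * ‖f‖ := by
  have h := lpNorm_le_of_ae_norm_le (p := 2) (by norm_num) (A := cauchyOp μ r f)
    (memLp_const (|1 - r|⁻¹ * ‖f‖ : ℂ)) (memLp_const (μ := ν) (0 : ℂ))
    zero_le_one zero_le_one (by
      filter_upwards [hν.ae_le ae_circleMeasure_norm_eq_one] with z hz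
      simpa using norm_cauchyOp_le hμ hr hr1 f hz)
  refine h.trans_eq ?_
  rw [lpNorm_const' (by norm_num) (by norm_num)]
  simp
  ring

theorem cauchyOp_sub_eq (hμ : ∀ᵐ ξ ∂μ, ‖ξ‖ = 1) {V : Lp ℂ 2 μ →ₗᵢ[ℂ] Lp ℂ 2 μ}
    (hV : ∀ f, V f =ᵐ[μ] fun ξ => conj ξ * f ξ) {r s : ℝ} (hr : 0 ≤ r) (hr1 : r ≠ 1)
    (hs : 0 ≤ s) (hs1 : s ≠ 1) (f : Lp ℂ 2 μ) {z : ℂ} (hz : ‖z‖ = 1) :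
    cauchyOp μ r f z - cauchyOp μ s f z =
      r * z * (cauchyOp μ r (V f) z - cauchyOp μ s (V f) z) +
        (r - s) * z * cauchyOp μ s (V f) z := by
  have hi := fun {r : ℝ} hr hr1 f => integrable_div hμ (r := r) hr hr1 f hz
  have hsub : Integrable (fun ξ => (r : ℂ) * z * (V f ξ / (1 - (r : ℂ) * conj ξ * z) -
      V f ξ / (1 - (s : ℂ) * conj ξ * z))) μ :=
    ((hi hr hr1 (V f)).sub (hi hs hs1 (V f))).const_mul _
  unfold cauchyOp
  rw [← integral_sub (hi hr hr1 f) (hi hs hs1 f),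
    ← integral_sub (hi hr hr1 (V f)) (hi hs hs1 (V f)), ← integral_const_mul, ← integral_const_mul,
    ← integral_add hsub ((hi hs hs1 (V f)).const_mul _)]
  refine integral_congr_ae ?_
  filter_upwards [hμ, hV f] with ξ hξ h
  have hne : ∀ {r : ℝ}, 0 ≤ r → r ≠ 1 → 1 - (r : ℂ) * conj ξ * z ≠ 0 := fun hr hr1 =>
    norm_pos_iff.1 ((abs_pos.2 (sub_ne_zero.2 hr1.symm)).trans_le (abs_one_sub_le_norm hr hξ hz))
  rw [h]
  simp only [div_eq_mul_inv]
  linear_combination f ξ * inv_mul_cancel₀ (hne hr hr1) - f ξ * inv_mul_cancel₀ (hne hs hs1)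

/-- The Schur multiplier `(1-sw)/(1-rw)` acts boundedly on the Cauchy kernel. -/
theorem lpNorm_cauchyOp_sub_le (hμ : ∀ᵐ ξ ∂μ, ‖ξ‖ = 1) {r s : ℝ} (hr : 0 ≤ r) (hr1 : r ≠ 1)
    (hs : 0 ≤ s) (hs1 : s ≠ 1) {ν : Measure ℂ} [IsFiniteMeasure ν] (hν : ν ≪ circleMeasure)
    {M : ℝ} (hM : 0 ≤ M) (h : ∀ f : Lp ℂ 2 μ, lpNorm (cauchyOp μ s f) 2 ν ≤ M * ‖f‖)
    (f : Lp ℂ 2 μ) :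
    lpNorm (cauchyOp μ r f - cauchyOp μ s f) 2 ν ≤ |r - s| * M / |1 - r| * ‖f‖ := by
  obtain ⟨V, hV⟩ := exists_linearIsometry_mul μ (u := fun ξ => conj ξ) (by fun_prop) (by simpa)
  obtain ⟨V', hV'⟩ := exists_linearIsometry_mul μ (u := fun ξ => ξ) (by fun_prop) hμ
  have hVV : ∀ f, V (V' f) = f := fun f => by
    apply Lp.ext
    filter_upwards [hV (V' f), hV' f, hμ] with ξ h1 h2 h3
    rw [h1, h2, ← mul_assoc, Complex.conj_mul', h3]
    simp
  have hrs : ‖(r : ℂ) - s‖ = |r - s| := by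
    rw [← Complex.ofReal_sub, Complex.norm_real, Real.norm_eq_abs]
  have hz := hν.ae_le ae_circleMeasure_norm_eq_one
  have hmem := fun {r : ℝ} hr hr1 f => memLp_cauchyOp hμ (r := r) hr hr1 f hν
  set φ : Lp ℂ 2 μ → ℝ := fun f => lpNorm (cauchyOp μ r f - cauchyOp μ s f) 2 ν
  have hK : ∀ f, φ f ≤ (|1 - r|⁻¹ * ν.real Set.univ ^ (2 : ℝ)⁻¹ + M) * ‖f‖ := fun f => by
    rw [add_mul]
    exact (lpNorm_sub_le (hmem hr hr1 f) (by norm_num)).trans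
      (add_le_add (lpNorm_cauchyOp_le hμ hr hr1 f hν) (h f))
  rcases lt_or_gt_of_ne hr1 with hlt | hgt
  · rw [abs_of_pos (sub_pos.2 hlt)]
    refine le_of_iterate V.norm_map hr hlt (by positivity) hK (fun f => ?_) f
    have h1 := lpNorm_le_of_ae_norm_le (p := 2) (by norm_num)
      (A := cauchyOp μ r f - cauchyOp μ s f)
      ((hmem hr hr1 (V f)).sub (hmem hs hs1 (V f))) (hmem hs hs1 (V f)) hr (abs_nonneg (r - s)) (by
        filter_upwards [hz] with z hz
        rw [Pi.sub_apply, cauchyOp_sub_eq hμ hV hr hr1 hs hs1 f hz]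
        refine (norm_add_le _ _).trans_eq ?_
        simp [hz, hrs, abs_of_nonneg hr])
    have h2 := h (V f)
    rw [V.norm_map] at h2
    rw [one_mul, mul_assoc]
    exact h1.trans (by gcongr)
  · rw [abs_sub_comm 1 r, abs_of_pos (sub_pos.2 hgt)]
    refine le_of_iterate V'.norm_map zero_le_one hgt (by positivity) hK (fun f => ?_) f
    have h1 := lpNorm_le_of_ae_norm_le (p := 2) (by norm_num)
      (A := (r : ℂ) • (cauchyOp μ r f - cauchyOp μ s f))
      ((hmem hr hr1 (V' f)).sub (hmem hs hs1 (V' f))) (hmem hs hs1 f) zero_le_one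
      (abs_nonneg (r - s)) (by
        filter_upwards [hz] with z hz
        have e := cauchyOp_sub_eq hμ hV hr hr1 hs hs1 (V' f) hz
        rw [hVV] at e
        have e' : (r : ℂ) * z * (cauchyOp μ r f z - cauchyOp μ s f z) =
          (cauchyOp μ r (V' f) z - cauchyOp μ s (V' f) z) - (r - s) * z * cauchyOp μ s f z := by
          rw [e]; ring
        have e'' := congrArg norm e'
        rw [norm_mul, norm_mul, hz, mul_one] at e''
        rw [Pi.smul_apply, Pi.sub_apply, Pi.sub_apply, smul_eq_mul, norm_mul, e'']
        refine (norm_sub_le _ _).trans_eq ?_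
        simp [hz, hrs])
    rw [lpNorm_const_smul] at h1
    rw [coe_nnnorm, Complex.norm_real, Real.norm_of_nonneg hr] at h1
    rw [mul_assoc]
    exact h1.trans (by gcongr; exact h f)

theorem lintegral_withDensity_sq {W : ℂ → ℝ} (hW : Measurable W) {F : ℂ → ℂ}
    (hF : Measurable F)
    (hmem : MemLp F 2 (circleMeasure.withDensity fun z => ENNReal.ofReal (W z))) :
    ENNReal.ofReal (lpNorm F 2 (circleMeasure.withDensity fun z => ENNReal.ofReal (W z)) ^ 2) =
      ∫⁻ z, ENNReal.ofReal (‖F z‖ ^ 2 * W z) ∂circleMeasure := by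
  rw [ENNReal.ofReal_pow lpNorm_nonneg, ofReal_lpNorm hmem]
  have h := eLpNorm_nnreal_pow_eq_lintegral (f := F) (p := 2)
    (μ := circleMeasure.withDensity fun z => ENNReal.ofReal (W z)) (by norm_num)
  simp only [NNReal.coe_ofNat, ENNReal.rpow_ofNat] at h
  rw [show ((2 : ℝ≥0) : ℝ≥0∞) = 2 by norm_num] at h
  rw [h, lintegral_withDensity_eq_lintegral_mul _ (by fun_prop) (by fun_prop)]
  congr 1 with z
  rw [Pi.mul_apply, ENNReal.ofReal_mul (by positivity), mul_comm,
    ENNReal.ofReal_pow (norm_nonneg _), ofReal_norm]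

theorem lintegral_cauchyOp_sq_le_of_lt_one (hμ : ∀ᵐ ξ ∂μ, ‖ξ‖ = 1) {γ : ℂ} (hγ : ‖γ‖ < 1)
    {r s : ℝ} (hr : 0 ≤ r) (hr1 : r ≠ 1) (hs0 : 0 < s) (hs : s < 1) (f : Lp ℂ 2 μ) :
    ∫⁻ z, ENNReal.ofReal (‖cauchyOp μ r f z‖ ^ 2 *
      vWeight γ (fun z => thetaG γ μ (s * z)) z) ∂circleMeasure ≤
      ENNReal.ofReal (((2 / s + |r - s| * (2 / s) / |1 - r|) * ‖f‖) ^ 2) := by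
  set W := vWeight γ (fun z => thetaG γ μ (s * z)) with hWdef
  have hW : Measurable W := measurable_vWeight_thetaG γ s
  set ν := circleMeasure.withDensity fun z => ENNReal.ofReal (W z)
  have hac : ν ≪ circleMeasure := withDensity_absolutelyContinuous _ _
  have hfin : IsFiniteMeasure ν := by
    refine isFiniteMeasure_withDensity ?_
    refine ((lintegral_mono_ae (g := fun _ => ENNReal.ofReal (2 * (‖1 - conj γ‖ ^ 2 /
      ((1 - conj γ).re - ‖1 - conj γ‖ ^ 2 / 2)))) ?_).trans_lt ?_).ne
    · filter_upwards [ae_circleMeasure_norm_eq_one] with z hz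
      have hl := norm_ofReal_mul_lt_one hs0.le hs hz
      rw [hWdef, vWeight_eq (Θ := fun z => thetaG γ μ (s * z)) hμ hγ hl rfl]
      have := re_div_le hγ (le_re_conj_mul_R1t hμ hl (1 - conj γ))
      gcongr
    · rw [lintegral_const, measure_univ, mul_one]
      exact ENNReal.ofReal_lt_top
  have hmeas := fun r => measurable_cauchyOp (μ := μ) r (Lp.stronglyMeasurable f).measurable
  have hM : ∀ f : Lp ℂ 2 μ, lpNorm (cauchyOp μ s f) 2 ν ≤ 2 / s * ‖f‖ := fun f => by
    have h := lintegral_cauchyOp_sq_le hμ hγ hs0 hs f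
    rw [← lintegral_withDensity_sq hW (measurable_cauchyOp s (Lp.stronglyMeasurable f).measurable)
      (memLp_cauchyOp hμ hs0.le hs.ne f hac), ENNReal.ofReal_le_ofReal_iff (by positivity)] at h
    exact (pow_le_pow_iff_left₀ lpNorm_nonneg (by positivity) two_ne_zero).1 h
  have hmem := memLp_cauchyOp hμ hr hr1 f hac
  rw [← lintegral_withDensity_sq hW (hmeas r) hmem]
  refine ENNReal.ofReal_le_ofReal (pow_le_pow_left₀ lpNorm_nonneg ?_ 2)
  rw [add_mul]
  exact (lpNorm_le_lpNorm_add_lpNorm_sub' (memLp_cauchyOp hμ hs0.le hs.ne f hac)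
    (by norm_num)).trans (add_le_add (hM f) (lpNorm_cauchyOp_sub_le hμ hr hr1 hs0.le hs.ne hac
      (by positivity) hM f))

theorem tendsto_vWeight {γ : ℂ} {Θ : ℕ → ℂ → ℂ} {Θ' : ℂ → ℂ} {z : ℂ}
    (h : Tendsto (fun n => Θ n z) atTop (𝓝 (Θ' z))) :
    Tendsto (fun n => vWeight γ (Θ n) z) atTop (𝓝 (vWeight γ Θ' z)) := by
  have hc : Continuous fun t : ℂ => vWeight γ (fun _ => t) z := by
    unfold vWeight BgammaFst BgammaSnd
    fun_prop
  exact (hc.tendsto (Θ' z)).comp h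

theorem NTlimIn.tendsto_radial {F : ℂ → ℂ} {z L : ℂ} (h : NTlimIn F z L) (hz : ‖z‖ = 1)
    {s : ℕ → ℝ} (hs0 : ∀ n, 0 < s n) (hs1 : ∀ n, s n < 1) (hs : Tendsto s atTop (𝓝 1)) :
    Tendsto (fun n => F (s n * z)) atTop (𝓝 L) := by
  refine (h 2 one_lt_two).comp (tendsto_nhdsWithin_iff.2 ⟨?_, Eventually.of_forall fun n => ?_⟩)
  · have : Tendsto (fun n => (s n : ℂ) * z) atTop (𝓝 ((1 : ℝ) * z)) :=
      ((Complex.continuous_ofReal.tendsto 1).comp hs).mul_const z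
    simpa using this
  · have h1 : ‖(s n : ℂ) * z‖ = s n := by simp [hz, abs_of_pos (hs0 n)]
    have h2 : ‖(s n : ℂ) * z - z‖ = 1 - s n := by
      have : (s n : ℂ) * z - z = ((s n - 1 : ℝ) : ℂ) * z := by push_cast; ring
      rw [this, norm_mul, hz, mul_one, Complex.norm_real, Real.norm_eq_abs, abs_sub_comm,
        abs_of_pos (sub_pos.2 (hs1 n))]
    refine ⟨h1.trans_lt (hs1 n), ?_⟩
    rw [h1, h2]
    linarith [hs1 n]

theorem lintegral_cauchyOp_sq_mul_vWeight_le (hμ : ∀ᵐ ξ ∂μ, ‖ξ‖ = 1) {γ : ℂ} (hγ : ‖γ‖ < 1)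
    {Θγ : ℂ → ℂ} (hΘγ : ∀ᵐ z ∂circleMeasure, NTlimIn (thetaG γ μ) z (Θγ z))
    {r : ℝ} (hr : 0 ≤ r) (hr1 : r ≠ 1) (f : Lp ℂ 2 μ) :
    ∫⁻ z, ENNReal.ofReal (‖cauchyOp μ r f z‖ ^ 2 * vWeight γ Θγ z) ∂circleMeasure ≤
      ENNReal.ofReal ((4 * ‖f‖) ^ 2) := by
  obtain ⟨s, -, hs01, hs⟩ := exists_seq_strictMono_tendsto' (zero_lt_one (α := ℝ))
  have hs0 := fun n => (hs01 n).1
  have hs1 := fun n => (hs01 n).2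
  have hr' : |1 - r| ≠ 0 := abs_ne_zero.2 (sub_ne_zero.2 hr1.symm)
  let W : ℕ → ℂ → ℝ := fun n => vWeight γ (fun z => thetaG γ μ (s n * z))
  have hlim : Tendsto (fun n => ENNReal.ofReal
      (((2 / s n + |r - s n| * (2 / s n) / |1 - r|) * ‖f‖) ^ 2)) atTop
      (𝓝 (ENNReal.ofReal ((4 * ‖f‖) ^ 2))) := by
    refine ENNReal.tendsto_ofReal ?_
    have h2 : Tendsto (fun n => 2 / s n) atTop (𝓝 (2 / 1)) := tendsto_const_nhds.div hs one_ne_zero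
    have h := (((h2.add (((hs.const_sub r).abs.mul h2).div_const |1 - r|)).mul_const ‖f‖).pow 2)
    convert h using 3
    rw [abs_sub_comm r 1]
    field_simp
    ring
  calc _ ≤ ∫⁻ z, liminf (fun n => ENNReal.ofReal (‖cauchyOp μ r f z‖ ^ 2 * W n z)) atTop
          ∂circleMeasure := by
        refine lintegral_mono_ae ?_
        filter_upwards [hΘγ, ae_circleMeasure_norm_eq_one] with z h hz
        have ht : Tendsto (fun n => W n z) atTop (𝓝 (vWeight γ Θγ z)) :=
          tendsto_vWeight (h.tendsto_radial hz hs0 hs1 hs)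
        exact (ENNReal.tendsto_ofReal (ht.const_mul _)).liminf_eq.ge
    _ ≤ liminf (fun n => ∫⁻ z, ENNReal.ofReal (‖cauchyOp μ r f z‖ ^ 2 * W n z)
          ∂circleMeasure) atTop := by
        refine lintegral_liminf_le fun n => ?_
        have h1 := measurable_cauchyOp (μ := μ) r (Lp.stronglyMeasurable f).measurable
        have h2 : Measurable (W n) := measurable_vWeight_thetaG γ (s n)
        fun_prop
    _ ≤ liminf (fun n => ENNReal.ofReal
          (((2 / s n + |r - s n| * (2 / s n) / |1 - r|) * ‖f‖) ^ 2)) atTop :=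
        liminf_le_liminf (Eventually.of_forall fun n =>
          lintegral_cauchyOp_sq_le_of_lt_one hμ hγ hr hr1 (hs0 n) (hs1 n) f)
    _ = _ := hlim.liminf_eq

end UniformBound

/-- For `|γ| < 1`, `v(z) = ‖B_γ(z)‖²` and `r ∈ [0,∞) ∖ {1}`, the integral
operators `T_r : L²(μ) → L²(v dm)`, `(T_r f)(z) = ∫ f(ξ)/(1-rξ̄z) dμ(ξ)`, are uniformly
bounded in `r`, with bound `C = 4`. -/
theorem statement11
    (μ : Measure ℂ) [IsProbabilityMeasure μ] (hμ : ∀ᵐ ξ ∂μ, ‖ξ‖ = 1)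
    (γ : ℂ) (hγ : ‖γ‖ < 1)
    -- nontangential boundary values of `θ_γ` on the circle:
    (Θγ : ℂ → ℂ)
    (hΘγ : ∀ᵐ z ∂circleMeasure, NTlimIn (thetaG γ μ) z (Θγ z))
    (r : ℝ) (hr0 : 0 ≤ r) (hr1 : r ≠ 1) (f : Lp ℂ 2 μ) :
    Real.sqrt (∫ z, ‖∫ ξ, f ξ / (1 - (r : ℂ) * conj ξ * z) ∂μ‖ ^ 2 * vWeight γ Θγ z
        ∂circleMeasure)
      ≤ 4 * ‖f‖ := by
  refine Real.sqrt_le_iff.2 ⟨by positivity, ?_⟩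
  by_cases hi : Integrable (fun z => ‖cauchyOp μ r f z‖ ^ 2 * vWeight γ Θγ z) circleMeasure
  · refine (ENNReal.ofReal_le_ofReal_iff (by positivity)).1 ?_
    refine (ofReal_integral_eq_lintegral_ofReal hi (ae_of_all _ fun z => ?_)).trans_le
      (lintegral_cauchyOp_sq_mul_vWeight_le hμ hγ hΘγ hr0 hr1 f)
    simp only [Pi.zero_apply, vWeight]
    positivity
  · exact (integral_undef hi).trans_le (by positivity)
end
end
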